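/- arXiv:2207.01799 — 7 statements merged into one kernel-verified Lean document; each statement's English description precedes it below -/
import Mathlib

section
/- The shifted Loewner matrix satisfies the Sylvester equation M 𝕃σ − 𝕃σ Λ = M V R − L W Λ, where M = diag(μ_1,…,μ_ν) and Λ = diag(λ_1,…,λ_ρ). -/
open Matrix

/-- The shifted Loewner matrix satisfies the Sylvester equation
`M 𝕃σ − 𝕃σ Λ = M V R − L W Λ`, where `M = diag(μ)` and `Λ = diag(λ)`. -/
theorem shifted_loewner_sylvester
    {m p ρ ν : ℕ} (hm : 0 < m) (hp : 0 < p) (hρ : 0 < ρ) (hν : 0 < ν)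
    (lam : Fin ρ → ℂ) (mu : Fin ν → ℂ)
    (hdistinct : ∀ (i : Fin ρ) (j : Fin ν), mu j ≠ lam i)
    (r : Fin ρ → Matrix (Fin m) (Fin 1) ℂ) (w : Fin ρ → Matrix (Fin p) (Fin 1) ℂ)
    (l : Fin ν → Matrix (Fin 1) (Fin p) ℂ) (v : Fin ν → Matrix (Fin 1) (Fin m) ℂ)
    (𝕃σ : Matrix (Fin ν) (Fin ρ) ℂ)
    (h𝕃σ : ∀ (j : Fin ν) (i : Fin ρ),
      𝕃σ j i = (mu j * ((v j * r i) 0 0) - lam i * ((l j * w i) 0 0)) / (mu j - lam i))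
    (R : Matrix (Fin m) (Fin ρ) ℂ) (hR : ∀ (k : Fin m) (i : Fin ρ), R k i = r i k 0)
    (W : Matrix (Fin p) (Fin ρ) ℂ) (hW : ∀ (k : Fin p) (i : Fin ρ), W k i = w i k 0)
    (L : Matrix (Fin ν) (Fin p) ℂ) (hL : ∀ (j : Fin ν) (k : Fin p), L j k = l j 0 k)
    (V : Matrix (Fin ν) (Fin m) ℂ) (hV : ∀ (j : Fin ν) (k : Fin m), V j k = v j 0 k) :
    Matrix.diagonal mu * 𝕃σ - 𝕃σ * Matrix.diagonal lam =
      Matrix.diagonal mu * V * R - L * W * Matrix.diagonal lam := by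
  have hVR (j : Fin ν) (i : Fin ρ) : (V * R) j i = (v j * r i) 0 0 := by
    simp only [Matrix.mul_apply, hV, hR]
  have hLW (j : Fin ν) (i : Fin ρ) : (L * W) j i = (l j * w i) 0 0 := by
    simp only [Matrix.mul_apply, hL, hW]
  ext j i
  have hne : mu j - lam i ≠ 0 := sub_ne_zero.mpr (hdistinct i j)
  rw [Matrix.mul_assoc, Matrix.sub_apply, Matrix.sub_apply, Matrix.diagonal_mul,
    Matrix.mul_diagonal, Matrix.diagonal_mul, Matrix.mul_diagonal, hVR, hLW, h𝕃σ,
    mul_comm _ (lam i), ← sub_mul, mul_div_cancel₀ _ hne, mul_comm _ (lam i)]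
end

section
/- For every index k ∈ {1,…,ρ}, the k-th column of the Loewner pencil evaluated at λ_k equals V r_k; that is, (𝕃σ − λ_k 𝕃) e_k = V r_k, where e_k is the k-th standard basis column vector of ℂ^ρ. -/
open Matrix

/-- For every index `k`, the `k`-th column of the Loewner pencil evaluated at `λ_k`
equals `V r_k`: `(𝕃σ − λ_k 𝕃) e_k = V r_k`, where `e_k` is the `k`-th standard basis
column vector of `ℂ^ρ`. -/
theorem loewner_pencil_column
    {m p ρ ν : ℕ} (hm : 0 < m) (hp : 0 < p) (hρ : 0 < ρ) (hν : 0 < ν)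
    (lam : Fin ρ → ℂ) (mu : Fin ν → ℂ)
    (hdistinct : ∀ (i : Fin ρ) (j : Fin ν), mu j ≠ lam i)
    (r : Fin ρ → Matrix (Fin m) (Fin 1) ℂ) (w : Fin ρ → Matrix (Fin p) (Fin 1) ℂ)
    (l : Fin ν → Matrix (Fin 1) (Fin p) ℂ) (v : Fin ν → Matrix (Fin 1) (Fin m) ℂ)
    (𝕃 : Matrix (Fin ν) (Fin ρ) ℂ)
    (h𝕃 : ∀ (j : Fin ν) (i : Fin ρ),
      𝕃 j i = ((v j * r i - l j * w i) 0 0) / (mu j - lam i))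
    (𝕃σ : Matrix (Fin ν) (Fin ρ) ℂ)
    (h𝕃σ : ∀ (j : Fin ν) (i : Fin ρ),
      𝕃σ j i = (mu j * ((v j * r i) 0 0) - lam i * ((l j * w i) 0 0)) / (mu j - lam i))
    (V : Matrix (Fin ν) (Fin m) ℂ) (hV : ∀ (j : Fin ν) (k : Fin m), V j k = v j 0 k)
    (k : Fin ρ)
    (e : Matrix (Fin ρ) (Fin 1) ℂ)
    (he : ∀ i : Fin ρ, e i 0 = if i = k then 1 else 0) :
    (𝕃σ - lam k • 𝕃) * e = V * r k := by
  ext j t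
  obtain rfl : t = 0 := Subsingleton.elim t 0
  have hVr : (V * r k) j 0 = (v j * r k) 0 0 := by
    simp only [Matrix.mul_apply, hV]
  have hcol : ((𝕃σ - lam k • 𝕃) * e) j 0 = 𝕃σ j k - lam k * 𝕃 j k := by
    simp [Matrix.mul_apply, he]
  have hne : mu j - lam k ≠ 0 := sub_ne_zero.mpr (hdistinct k j)
  rw [hcol, hVr, h𝕃, h𝕃σ, Matrix.sub_apply]
  field_simp
  ring
end

section
/- Suppose ν = ρ (the Loewner pencil is square) and for some index k ∈ {1,…,ρ} the matrix 𝕃σ − λ_k 𝕃 is invertible. Then the Loewner model with realization Ẽ = −𝕃, Ã = −𝕃σ, B̃ = V, C̃ = W satisfies the right tangential interpolation condition at λ_k: W (𝕃σ − λ_k 𝕃)^{-1} V r_k = w_k, i.e. C̃ (λ_k Ẽ − Ã)^{-1} B̃ r_k = w_k. -/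
open Matrix

/-- Suppose `ν = ρ` (the Loewner pencil is square) and `𝕃σ − λ_k 𝕃` is invertible for
some index `k`. Then the Loewner model `Ẽ = −𝕃, Ã = −𝕃σ, B̃ = V, C̃ = W` satisfies the
right tangential interpolation condition at `λ_k`:
`W (𝕃σ − λ_k 𝕃)⁻¹ V r_k = w_k`, i.e. `C̃ (λ_k Ẽ − Ã)⁻¹ B̃ r_k = w_k`. -/
theorem loewner_model_right_interpolation
    {m p ρ : ℕ} (hm : 0 < m) (hp : 0 < p) (hρ : 0 < ρ)
    (lam : Fin ρ → ℂ) (mu : Fin ρ → ℂ)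
    (hdistinct : ∀ (i : Fin ρ) (j : Fin ρ), mu j ≠ lam i)
    (r : Fin ρ → Matrix (Fin m) (Fin 1) ℂ) (w : Fin ρ → Matrix (Fin p) (Fin 1) ℂ)
    (l : Fin ρ → Matrix (Fin 1) (Fin p) ℂ) (v : Fin ρ → Matrix (Fin 1) (Fin m) ℂ)
    (𝕃 : Matrix (Fin ρ) (Fin ρ) ℂ)
    (h𝕃 : ∀ (j : Fin ρ) (i : Fin ρ),
      𝕃 j i = ((v j * r i - l j * w i) 0 0) / (mu j - lam i))
    (𝕃σ : Matrix (Fin ρ) (Fin ρ) ℂ)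
    (h𝕃σ : ∀ (j : Fin ρ) (i : Fin ρ),
      𝕃σ j i = (mu j * ((v j * r i) 0 0) - lam i * ((l j * w i) 0 0)) / (mu j - lam i))
    (W : Matrix (Fin p) (Fin ρ) ℂ) (hW : ∀ (k : Fin p) (i : Fin ρ), W k i = w i k 0)
    (V : Matrix (Fin ρ) (Fin m) ℂ) (hV : ∀ (j : Fin ρ) (k : Fin m), V j k = v j 0 k)
    (k : Fin ρ) (hinv : IsUnit (𝕃σ - lam k • 𝕃)) :
    W * (𝕃σ - lam k • 𝕃)⁻¹ * V * r k = w k := by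
  have hdet : IsUnit (𝕃σ - lam k • 𝕃).det := (Matrix.isUnit_iff_isUnit_det _).mp hinv
  have hcol : V * r k = (𝕃σ - lam k • 𝕃) * Matrix.single k (0 : Fin 1) (1 : ℂ) := by
    ext j c
    obtain rfl : c = 0 := Subsingleton.elim _ _
    have hne : mu j - lam k ≠ 0 := sub_ne_zero.mpr (hdistinct k j)
    have hVr : (V * r k) j 0 = (v j * r k) 0 0 := by
      simp only [Matrix.mul_apply, hV]
    rw [hVr, Matrix.mul_single_apply_same, mul_one, Matrix.sub_apply, Matrix.smul_apply,
      smul_eq_mul, h𝕃, h𝕃σ, Matrix.sub_apply]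
    field_simp
    ring
  rw [Matrix.mul_assoc, hcol, Matrix.mul_assoc, Matrix.nonsing_inv_mul_cancel_left _ _ hdet]
  ext a c
  obtain rfl : c = 0 := Subsingleton.elim _ _
  rw [Matrix.mul_single_apply_same, mul_one, hW]
end

section
/- Suppose ν = ρ (the Loewner pencil is square) and for some index k ∈ {1,…,ν} the matrix 𝕃σ − μ_k 𝕃 is invertible. Then the Loewner model with realization Ẽ = −𝕃, Ã = −𝕃σ, B̃ = V, C̃ = W satisfies the left tangential interpolation condition at μ_k: l_k W (𝕃σ − μ_k 𝕃)^{-1} V = v_k, i.e. l_k C̃ (μ_k Ẽ − Ã)^{-1} B̃ = v_k. -/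
open Matrix

/-- Suppose `ν = ρ` (the Loewner pencil is square) and `𝕃σ − μ_k 𝕃` is invertible for
some index `k`. Then the Loewner model `Ẽ = −𝕃, Ã = −𝕃σ, B̃ = V, C̃ = W` satisfies the
left tangential interpolation condition at `μ_k`:
`l_k W (𝕃σ − μ_k 𝕃)⁻¹ V = v_k`, i.e. `l_k C̃ (μ_k Ẽ − Ã)⁻¹ B̃ = v_k`. -/
theorem loewner_model_left_interpolation
    {m p ρ : ℕ} (hm : 0 < m) (hp : 0 < p) (hρ : 0 < ρ)
    (lam : Fin ρ → ℂ) (mu : Fin ρ → ℂ)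
    (hdistinct : ∀ (i : Fin ρ) (j : Fin ρ), mu j ≠ lam i)
    (r : Fin ρ → Matrix (Fin m) (Fin 1) ℂ) (w : Fin ρ → Matrix (Fin p) (Fin 1) ℂ)
    (l : Fin ρ → Matrix (Fin 1) (Fin p) ℂ) (v : Fin ρ → Matrix (Fin 1) (Fin m) ℂ)
    (𝕃 : Matrix (Fin ρ) (Fin ρ) ℂ)
    (h𝕃 : ∀ (j : Fin ρ) (i : Fin ρ),
      𝕃 j i = ((v j * r i - l j * w i) 0 0) / (mu j - lam i))
    (𝕃σ : Matrix (Fin ρ) (Fin ρ) ℂ)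
    (h𝕃σ : ∀ (j : Fin ρ) (i : Fin ρ),
      𝕃σ j i = (mu j * ((v j * r i) 0 0) - lam i * ((l j * w i) 0 0)) / (mu j - lam i))
    (W : Matrix (Fin p) (Fin ρ) ℂ) (hW : ∀ (k : Fin p) (i : Fin ρ), W k i = w i k 0)
    (V : Matrix (Fin ρ) (Fin m) ℂ) (hV : ∀ (j : Fin ρ) (k : Fin m), V j k = v j 0 k)
    (k : Fin ρ) (hinv : IsUnit (𝕃σ - mu k • 𝕃)) :
    l k * W * (𝕃σ - mu k • 𝕃)⁻¹ * V = v k := by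
  have hrow : l k * W = (Matrix.single 0 k 1 : Matrix (Fin 1) (Fin ρ) ℂ) * (𝕃σ - mu k • 𝕃) := by
    ext a i
    obtain rfl : a = 0 := Subsingleton.elim _ _
    have hne : mu k - lam i ≠ 0 := sub_ne_zero.mpr (hdistinct i k)
    have hlW : (l k * W) 0 i = (l k * w i) 0 0 := by
      simp only [Matrix.mul_apply, hW]
    rw [hlW, Matrix.single_mul_apply_same, one_mul, Matrix.sub_apply, Matrix.smul_apply, h𝕃, h𝕃σ,
      Matrix.sub_apply, smul_eq_mul]
    field_simp
    ring
  rw [hrow, Matrix.mul_nonsing_inv_cancel_right _ _ ((Matrix.isUnit_iff_isUnit_det _).mp hinv)]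
  ext a j
  obtain rfl : a = 0 := Subsingleton.elim _ _
  rw [Matrix.single_mul_apply_same, one_mul, hV]
end

section
/- Suppose the tangential data is generated by the transfer function H(s) = C (s E − A)^{-1} B of a linear descriptor system, i.e. w_i = H(λ_i) r_i and v_j = l_j H(μ_j), where λ_i E − A and μ_j E − A are invertible for all i, j. Then every entry of the Loewner matrix admits the factorization 𝕃_{ji} = − l_j C (μ_j E − A)^{-1} E (λ_i E − A)^{-1} B r_i. -/
open Matrix

/-- The resolvent identity for a matrix pencil `s E − A`. -/
theorem Matrix.inv_pencil_sub_inv_pencil {ι K : Type*} [Fintype ι] [DecidableEq ι] [CommRing K]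
    (E A : Matrix ι ι K) {a b : K} (ha : IsUnit (a • E - A)) (hb : IsUnit (b • E - A)) :
    (a • E - A)⁻¹ - (b • E - A)⁻¹ = (b - a) • ((a • E - A)⁻¹ * E * (b • E - A)⁻¹) := by
  rw [Matrix.inv_sub_inv (iff_of_true ha hb), sub_sub_sub_cancel_right, ← sub_smul,
    Matrix.mul_smul, Matrix.smul_mul]

/-- If the tangential data is generated by the transfer function
`H(s) = C (s E − A)⁻¹ B` of a linear descriptor system, i.e. `w_i = H(λ_i) r_i` and
`v_j = l_j H(μ_j)`, with `λ_i E − A` and `μ_j E − A` invertible for all `i, j`, then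
every entry of the Loewner matrix factors as
`𝕃_{ji} = − l_j C (μ_j E − A)⁻¹ E (λ_i E − A)⁻¹ B r_i`. -/
theorem loewner_entry_factorization
    {m p ρ ν n : ℕ} (hm : 0 < m) (hp : 0 < p) (hρ : 0 < ρ) (hν : 0 < ν) (hn : 0 < n)
    (E A : Matrix (Fin n) (Fin n) ℂ)
    (B : Matrix (Fin n) (Fin m) ℂ) (C : Matrix (Fin p) (Fin n) ℂ)
    (lam : Fin ρ → ℂ) (mu : Fin ν → ℂ)
    (hdistinct : ∀ (i : Fin ρ) (j : Fin ν), mu j ≠ lam i)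
    (hlam : ∀ i : Fin ρ, IsUnit (lam i • E - A))
    (hmu : ∀ j : Fin ν, IsUnit (mu j • E - A))
    (r : Fin ρ → Matrix (Fin m) (Fin 1) ℂ) (l : Fin ν → Matrix (Fin 1) (Fin p) ℂ)
    (H : ℂ → Matrix (Fin p) (Fin m) ℂ)
    (hH : ∀ s : ℂ, H s = C * (s • E - A)⁻¹ * B)
    (w : Fin ρ → Matrix (Fin p) (Fin 1) ℂ) (hw : ∀ i : Fin ρ, w i = H (lam i) * r i)
    (v : Fin ν → Matrix (Fin 1) (Fin m) ℂ) (hv : ∀ j : Fin ν, v j = l j * H (mu j))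
    (𝕃 : Matrix (Fin ν) (Fin ρ) ℂ)
    (h𝕃 : ∀ (j : Fin ν) (i : Fin ρ),
      𝕃 j i = ((v j * r i - l j * w i) 0 0) / (mu j - lam i)) :
    ∀ (j : Fin ν) (i : Fin ρ),
      𝕃 j i = -((l j * C * (mu j • E - A)⁻¹ * E * (lam i • E - A)⁻¹ * B * r i) 0 0) := by
  intro j i
  have hnum : v j * r i - l j * w i = (lam i - mu j) •
      (l j * C * (mu j • E - A)⁻¹ * E * (lam i • E - A)⁻¹ * B * r i) := by
    calc v j * r i - l j * w i
        = l j * C * ((mu j • E - A)⁻¹ - (lam i • E - A)⁻¹) * B * r i := by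
          simp only [hv, hw, hH, Matrix.mul_sub, Matrix.sub_mul, Matrix.mul_assoc]
      _ = _ := by
          rw [Matrix.inv_pencil_sub_inv_pencil E A (hmu j) (hlam i)]
          simp only [Matrix.mul_smul, Matrix.smul_mul, Matrix.mul_assoc]
  rw [h𝕃, hnum, Matrix.smul_apply, smul_eq_mul, div_eq_iff (sub_ne_zero.2 (hdistinct i j))]
  ring
end

section
/- Suppose the tangential data is generated by the transfer function H(s) = C (s E − A)^{-1} B of a linear descriptor system, i.e. w_i = H(λ_i) r_i and v_j = l_j H(μ_j), where λ_i E − A and μ_j E − A are invertible for all i, j. Then every entry of the shifted Loewner matrix admits the factorization (𝕃σ)_{ji} = − l_j C (μ_j E − A)^{-1} A (λ_i E − A)^{-1} B r_i. -/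
open Matrix

/-- The shifted resolvent identity for a matrix pencil `s E − A`. -/
theorem Matrix.smul_inv_pencil_sub_smul_inv_pencil {ι R : Type*} [Fintype ι] [DecidableEq ι]
    [CommRing R] (E A : Matrix ι ι R) {a b : R}
    (ha : IsUnit (a • E - A)) (hb : IsUnit (b • E - A)) :
    a • (a • E - A)⁻¹ - b • (b • E - A)⁻¹ =
      -((a - b) • ((a • E - A)⁻¹ * A * (b • E - A)⁻¹)) := by
  rw [Matrix.isUnit_iff_isUnit_det] at ha hb
  have hcomb : a • (b • E - A) - b • (a • E - A) = -((a - b) • A) := by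
    module
  calc
    a • (a • E - A)⁻¹ - b • (b • E - A)⁻¹ =
        (a • E - A)⁻¹ * (a • (b • E - A) - b • (a • E - A)) * (b • E - A)⁻¹ := by
      rw [Matrix.mul_sub, Matrix.sub_mul, Matrix.mul_smul, Matrix.mul_smul, Matrix.smul_mul,
        Matrix.smul_mul, Matrix.mul_nonsing_inv_cancel_right _ _ hb,
        Matrix.nonsing_inv_mul _ ha, Matrix.one_mul]
    _ = -((a - b) • ((a • E - A)⁻¹ * A * (b • E - A)⁻¹)) := by
      rw [hcomb, Matrix.mul_neg, Matrix.neg_mul, Matrix.mul_smul, Matrix.smul_mul]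

/-- If the tangential data is generated by the transfer function
`H(s) = C (s E − A)⁻¹ B` of a linear descriptor system, i.e. `w_i = H(λ_i) r_i` and
`v_j = l_j H(μ_j)`, with `λ_i E − A` and `μ_j E − A` invertible for all `i, j`, then
every entry of the shifted Loewner matrix factors as
`(𝕃σ)_{ji} = − l_j C (μ_j E − A)⁻¹ A (λ_i E − A)⁻¹ B r_i`. -/
theorem shifted_loewner_entry_factorization
    {m p ρ ν n : ℕ} (hm : 0 < m) (hp : 0 < p) (hρ : 0 < ρ) (hν : 0 < ν) (hn : 0 < n)
    (E A : Matrix (Fin n) (Fin n) ℂ)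
    (B : Matrix (Fin n) (Fin m) ℂ) (C : Matrix (Fin p) (Fin n) ℂ)
    (lam : Fin ρ → ℂ) (mu : Fin ν → ℂ)
    (hdistinct : ∀ (i : Fin ρ) (j : Fin ν), mu j ≠ lam i)
    (hlam : ∀ i : Fin ρ, IsUnit (lam i • E - A))
    (hmu : ∀ j : Fin ν, IsUnit (mu j • E - A))
    (r : Fin ρ → Matrix (Fin m) (Fin 1) ℂ) (l : Fin ν → Matrix (Fin 1) (Fin p) ℂ)
    (H : ℂ → Matrix (Fin p) (Fin m) ℂ)
    (hH : ∀ s : ℂ, H s = C * (s • E - A)⁻¹ * B)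
    (w : Fin ρ → Matrix (Fin p) (Fin 1) ℂ) (hw : ∀ i : Fin ρ, w i = H (lam i) * r i)
    (v : Fin ν → Matrix (Fin 1) (Fin m) ℂ) (hv : ∀ j : Fin ν, v j = l j * H (mu j))
    (𝕃σ : Matrix (Fin ν) (Fin ρ) ℂ)
    (h𝕃σ : ∀ (j : Fin ν) (i : Fin ρ),
      𝕃σ j i = (mu j * ((v j * r i) 0 0) - lam i * ((l j * w i) 0 0)) / (mu j - lam i)) :
    ∀ (j : Fin ν) (i : Fin ρ),
      𝕃σ j i = -((l j * C * (mu j • E - A)⁻¹ * A * (lam i • E - A)⁻¹ * B * r i) 0 0) := by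
  intro j i
  have hfactor : mu j • (v j * r i) - lam i • (l j * w i) =
      -((mu j - lam i) •
        (l j * C * (mu j • E - A)⁻¹ * A * (lam i • E - A)⁻¹ * B * r i)) := by
    have h := congrArg (fun X => l j * C * X * (B * r i))
      (Matrix.smul_inv_pencil_sub_smul_inv_pencil E A (hmu j) (hlam i))
    simpa only [hv, hw, hH, Matrix.mul_sub, Matrix.sub_mul, Matrix.mul_smul, Matrix.smul_mul,
      Matrix.mul_neg, Matrix.neg_mul, Matrix.mul_assoc] using h
  have hentry := congrFun (congrFun hfactor 0) 0
  simp only [Matrix.sub_apply, Matrix.neg_apply, Matrix.smul_apply, smul_eq_mul] at hentry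
  rw [h𝕃σ, hentry, neg_div, mul_div_cancel_left₀ _ (sub_ne_zero.mpr (hdistinct i j))]
end

section
/- Suppose the tangential data is generated by the transfer function H(s) = C (s E − A)^{-1} B of a linear descriptor system, i.e. w_i = H(λ_i) r_i and v_j = l_j H(μ_j), where λ_i E − A and μ_j E − A are invertible for all i, j. Then for any s ∈ ℂ, every entry of the Loewner pencil admits the factorization (𝕃σ − s 𝕃)_{ji} = l_j C (μ_j E − A)^{-1} (s E − A) (λ_i E − A)^{-1} B r_i. -/
open Matrix

/-- Resolvent-type identity for a matrix pencil `s E − A` evaluated between two regular points. -/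
theorem sub_smul_inv_mul_pencil_mul_inv {ι K : Type*} [Fintype ι] [DecidableEq ι] [Field K]
    (E A : Matrix ι ι K) {a b : K} (ha : IsUnit (a • E - A)) (hb : IsUnit (b • E - A)) (s : K) :
    (a - b) • ((a • E - A)⁻¹ * (s • E - A) * (b • E - A)⁻¹) =
      (a - s) • (a • E - A)⁻¹ - (b - s) • (b • E - A)⁻¹ := by
  have hpencil : (a - b) • (s • E - A) = (a - s) • (b • E - A) - (b - s) • (a • E - A) := by
    module
  rw [← Matrix.smul_mul, ← Matrix.mul_smul, hpencil, Matrix.mul_sub, Matrix.sub_mul,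
    Matrix.mul_smul, Matrix.mul_smul, Matrix.smul_mul, Matrix.smul_mul,
    Matrix.nonsing_inv_mul _ ((Matrix.isUnit_iff_isUnit_det _).mp ha), Matrix.mul_assoc,
    Matrix.mul_nonsing_inv _ ((Matrix.isUnit_iff_isUnit_det _).mp hb), Matrix.mul_one,
    Matrix.one_mul]

/-- If the tangential data is generated by the transfer function
`H(s) = C (s E − A)⁻¹ B` of a linear descriptor system, i.e. `w_i = H(λ_i) r_i` and
`v_j = l_j H(μ_j)`, with `λ_i E − A` and `μ_j E − A` invertible for all `i, j`, then
for any `s ∈ ℂ`, every entry of the Loewner pencil factors as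
`(𝕃σ − s 𝕃)_{ji} = l_j C (μ_j E − A)⁻¹ (s E − A) (λ_i E − A)⁻¹ B r_i`. -/
theorem loewner_pencil_entry_factorization
    {m p ρ ν n : ℕ} (hm : 0 < m) (hp : 0 < p) (hρ : 0 < ρ) (hν : 0 < ν) (hn : 0 < n)
    (E A : Matrix (Fin n) (Fin n) ℂ)
    (B : Matrix (Fin n) (Fin m) ℂ) (C : Matrix (Fin p) (Fin n) ℂ)
    (lam : Fin ρ → ℂ) (mu : Fin ν → ℂ)
    (hdistinct : ∀ (i : Fin ρ) (j : Fin ν), mu j ≠ lam i)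
    (hlam : ∀ i : Fin ρ, IsUnit (lam i • E - A))
    (hmu : ∀ j : Fin ν, IsUnit (mu j • E - A))
    (r : Fin ρ → Matrix (Fin m) (Fin 1) ℂ) (l : Fin ν → Matrix (Fin 1) (Fin p) ℂ)
    (H : ℂ → Matrix (Fin p) (Fin m) ℂ)
    (hH : ∀ s : ℂ, H s = C * (s • E - A)⁻¹ * B)
    (w : Fin ρ → Matrix (Fin p) (Fin 1) ℂ) (hw : ∀ i : Fin ρ, w i = H (lam i) * r i)
    (v : Fin ν → Matrix (Fin 1) (Fin m) ℂ) (hv : ∀ j : Fin ν, v j = l j * H (mu j))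
    (𝕃 : Matrix (Fin ν) (Fin ρ) ℂ)
    (h𝕃 : ∀ (j : Fin ν) (i : Fin ρ),
      𝕃 j i = ((v j * r i - l j * w i) 0 0) / (mu j - lam i))
    (𝕃σ : Matrix (Fin ν) (Fin ρ) ℂ)
    (h𝕃σ : ∀ (j : Fin ν) (i : Fin ρ),
      𝕃σ j i = (mu j * ((v j * r i) 0 0) - lam i * ((l j * w i) 0 0)) / (mu j - lam i)) :
    ∀ (s : ℂ) (j : Fin ν) (i : Fin ρ),
      (𝕃σ - s • 𝕃) j i =
        (l j * C * (mu j • E - A)⁻¹ * (s • E - A) * (lam i • E - A)⁻¹ * B * r i) 0 0 := by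
  intro s j i
  have hne : mu j - lam i ≠ 0 := sub_ne_zero.mpr (hdistinct i j)
  have key := congrArg (fun X => (l j * C * X * (B * r i)) 0 0)
    (sub_smul_inv_mul_pencil_mul_inv E A (hmu j) (hlam i) s)
  simp only [Matrix.mul_sub, Matrix.sub_mul, Matrix.mul_smul, Matrix.smul_mul, Matrix.sub_apply,
    Matrix.smul_apply, smul_eq_mul, ← Matrix.mul_assoc] at key
  simp only [Matrix.sub_apply, Matrix.smul_apply, smul_eq_mul, h𝕃, h𝕃σ, hv, hw, hH,
    Matrix.mul_sub, Matrix.sub_mul, Matrix.mul_smul, Matrix.smul_mul, ← Matrix.mul_assoc]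
  field_simp
  linear_combination -key
end
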